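/- Let S be a profinite semigroup that is reductive. Then the translational hull Ω(S), with the compact-open topology, is a profinite semigroup, i.e., a compact Hausdorff zero-dimensional topological semigroup with continuous multiplication. -/

import Mathlib

open Filter Topology

section Hull

variable {T : Type*} [Semigroup T] [TopologicalSpace T]

/-- A left translation of a topological semigroup. -/
def IsLeftTranslation (l : C(T, T)) : Prop :=
  ∀ s t : T, l (s * t) = l s * t

/-- A right translation of a topological semigroup. -/
def IsRightTranslation (r : C(T, T)) : Prop :=
  ∀ s t : T, r (s * t) = s * r t

/-- A bitranslation: a linked pair of a left and a right translation. -/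
def IsBitranslation (p : C(T, T) × C(T, T)) : Prop :=
  IsLeftTranslation p.1 ∧ IsRightTranslation p.2 ∧ ∀ s t : T, s * p.1 t = p.2 s * t

/-- The translational hull of a topological semigroup, topologized as a subspace of
`C(T,T) × C(T,T)` where both factors carry the compact-open topology. -/
abbrev TranslationalHull (T : Type*) [Semigroup T] [TopologicalSpace T] :=
  { p : C(T, T) × C(T, T) // IsBitranslation p }

instance : Mul (TranslationalHull T) where
  mul p q :=
    ⟨(p.1.1.comp q.1.1, q.1.2.comp p.1.2), by
      obtain ⟨⟨l₁, r₁⟩, hL₁, hR₁, hk₁⟩ := p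
      obtain ⟨⟨l₂, r₂⟩, hL₂, hR₂, hk₂⟩ := q
      refine ⟨fun s t => ?_, fun s t => ?_, fun s t => ?_⟩
      · simp only [ContinuousMap.comp_apply]
        rw [hL₂, hL₁]
      · simp only [ContinuousMap.comp_apply]
        rw [hR₁, hR₂]
      · simp only [ContinuousMap.comp_apply]
        rw [hk₁, hk₂]⟩

end Hull

/-- The pairs of (not necessarily continuous) linked left and right translations of `T`. -/
def linkedPairs (T : Type*) [Semigroup T] : Set ((T → T) × (T → T)) :=
  { p | (∀ s t, p.1 (s * t) = p.1 s * t) ∧ (∀ s t, p.2 (s * t) = s * p.2 t) ∧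
    ∀ s t, s * p.1 t = p.2 s * t }

theorem isClosed_linkedPairs {T : Type*} [Semigroup T] [TopologicalSpace T] [ContinuousMul T]
    [T2Space T] : IsClosed (linkedPairs T) := by
  simp only [linkedPairs, Set.ofPred_and, Set.ofPred_forall]
  refine .inter ?_ (.inter ?_ ?_) <;>
    exact isClosed_iInter fun s => isClosed_iInter fun t => isClosed_eq (by fun_prop) (by fun_prop)

section Evaluation

variable {T : Type*} [Semigroup T] [TopologicalSpace T] [ContinuousMul T] [CompactSpace T]
  [T2Space T]

/-- If right multiplications separate points, linked left translations evaluate jointly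
continuously in the translation (for pointwise convergence) and the point. -/
theorem continuous_linkedPairs_eval_fst
    (h : Function.Injective fun (s : T) (u : T) => u * s) :
    Continuous fun x : linkedPairs T × T => x.1.1.1 x.2 := by
  have hemb : IsClosedEmbedding fun (s : T) (u : T) => u * s :=
    Continuous.isClosedEmbedding (by fun_prop) h
  rw [hemb.isInducing.continuous_iff]
  have heq : (fun (s : T) (u : T) => u * s) ∘ (fun x : linkedPairs T × T => x.1.1.1 x.2) =
      fun x u => x.1.1.2 u * x.2 := by
    ext x u
    exact x.1.2.2.2 u x.2
  rw [heq]
  fun_prop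

/-- If left multiplications separate points, linked right translations evaluate jointly
continuously in the translation (for pointwise convergence) and the point. -/
theorem continuous_linkedPairs_eval_snd
    (h : Function.Injective fun (s : T) (u : T) => s * u) :
    Continuous fun x : linkedPairs T × T => x.1.1.2 x.2 := by
  have hemb : IsClosedEmbedding fun (s : T) (u : T) => s * u :=
    Continuous.isClosedEmbedding (by fun_prop) h
  rw [hemb.isInducing.continuous_iff]
  have heq : (fun (s : T) (u : T) => s * u) ∘ (fun x : linkedPairs T × T => x.1.1.2 x.2) =
      fun x u => x.2 * x.1.1.1 u := by
    ext x u
    exact (x.1.2.2.2 x.2 u).symm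
  rw [heq]
  fun_prop

theorem compactSpace_translationalHull
    (hleft : Function.Injective fun (s : T) (u : T) => s * u)
    (hright : Function.Injective fun (s : T) (u : T) => u * s) :
    CompactSpace (TranslationalHull T) := by
  have : CompactSpace (linkedPairs T) :=
    isCompact_iff_compactSpace.mp isClosed_linkedPairs.isCompact
  let l : C(linkedPairs T, C(T, T)) :=
    ContinuousMap.curry ⟨_, continuous_linkedPairs_eval_fst hright⟩
  let r : C(linkedPairs T, C(T, T)) :=
    ContinuousMap.curry ⟨_, continuous_linkedPairs_eval_snd hleft⟩
  let f : linkedPairs T → TranslationalHull T := fun x => ⟨(l x, r x), x.2⟩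
  have hf : Continuous f := by fun_prop
  have hsurj : Function.Surjective f := fun p => ⟨⟨(p.1.1, p.1.2), p.2⟩, rfl⟩
  exact hsurj.compactSpace hf

end Evaluation

theorem totallyDisconnectedSpace_translationalHull {T : Type*} [Semigroup T] [TopologicalSpace T]
    [TotallyDisconnectedSpace T] : TotallyDisconnectedSpace (TranslationalHull T) := by
  let f : TranslationalHull T → (T → T) × (T → T) := fun p => (p.1.1, p.1.2)
  have hf : Continuous f := by
    refine .prodMk ?_ ?_ <;> exact continuous_pi fun t => by fun_prop
  have hinj : Function.Injective f := fun p q h =>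
    Subtype.ext (Prod.ext (DFunLike.coe_injective (congrArg Prod.fst h))
      (DFunLike.coe_injective (congrArg Prod.snd h)))
  exact ⟨isTotallyDisconnected_of_image hf.continuousOn hinj
    (isTotallyDisconnected_of_totallyDisconnectedSpace _)⟩

theorem continuous_mul_translationalHull {T : Type*} [Semigroup T] [TopologicalSpace T]
    [LocallyCompactSpace T] :
    Continuous fun p : TranslationalHull T × TranslationalHull T => p.1 * p.2 := by
  refine Continuous.subtype_mk (f := fun p : TranslationalHull T × TranslationalHull T =>
    (p.1.1.1.comp p.2.1.1, p.2.1.2.comp p.1.1.2)) ?_ _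
  refine .prodMk (.compCM ?_ ?_) (.compCM ?_ ?_) <;> fun_prop

/-- If `S` is a profinite (compact Hausdorff zero-dimensional topological) semigroup which is
reductive, then its translational hull, with the compact-open topology, is a profinite
semigroup: compact, Hausdorff, zero-dimensional, with continuous multiplication. -/
theorem translationalHull_of_profinite_reductive_is_profinite
    {S : Type*} [Semigroup S] [TopologicalSpace S] [ContinuousMul S]
    [CompactSpace S] [T2Space S] [TotallyDisconnectedSpace S]
    (hleft : Function.Injective fun s : S =>
      (⟨fun u => s * u, continuous_mul_left s⟩ : C(S, S)))
    (hright : Function.Injective fun s : S =>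
      (⟨fun u => u * s, continuous_mul_right s⟩ : C(S, S))) :
    CompactSpace (TranslationalHull S) ∧ T2Space (TranslationalHull S) ∧
      TotallyDisconnectedSpace (TranslationalHull S) ∧
      Continuous (fun p : TranslationalHull S × TranslationalHull S => p.1 * p.2) := by
  exact ⟨compactSpace_translationalHull
      (fun s t h => hleft (ContinuousMap.ext (congrFun h)))
      (fun s t h => hright (ContinuousMap.ext (congrFun h))),
    inferInstance, totallyDisconnectedSpace_translationalHull, continuous_mul_translationalHull⟩
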